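/- arXiv:2204.03826 — 2 statements merged into one kernel-verified Lean document; each statement's English description precedes it below -/
import Mathlib

section
/- Fix real constants c > 0 and δ > 0. Let (G_i) be a sequence of finite nonabelian groups with |G_i| → ∞ such that n(G_i) ≥ c·|G_i|^δ for all i, and for each i let S_i, T_i, U_i be subsets of G_i satisfying the triple product property. Then limsup_{i→∞} log(|S_i|·|T_i|·|U_i|) / log|G_i| < 3/2. In particular, no such sequence of groups meets the packing bound. -/
/-- The quotient set `Q(X) = {x * x'⁻¹ : x, x' ∈ X}` of a subset of a group. -/
def quotientSet {G : Type*} [Group G] (X : Set G) : Set G :=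
  {q | ∃ x ∈ X, ∃ x' ∈ X, q = x * x'⁻¹}

/-- The triple product property for subsets of a group. -/
def TripleProductProperty {G : Type*} [Group G] (S T U : Set G) : Prop :=
  ∀ s ∈ quotientSet S, ∀ t ∈ quotientSet T, ∀ u ∈ quotientSet U,
    s * t * u = 1 → s = 1 ∧ t = 1 ∧ u = 1

/-- `n(G)`: the smallest dimension of a complex irreducible representation of `G`
of dimension greater than `1`. -/
noncomputable def minNontrivIrrepDim (G : Type) [Group G] [Fintype G] : ℕ :=
  sInf {d : ℕ | 1 < d ∧
    ∃ V : FDRep ℂ G, CategoryTheory.Simple V ∧ Module.finrank ℂ V = d}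

theorem FDRep.simple_of_isIrreducible {G V : Type} [Group G] [Finite G] [AddCommGroup V]
    [Module ℂ V] [FiniteDimensional ℂ V] (ρ : Representation ℂ G V) [ρ.IsIrreducible] :
    CategoryTheory.Simple (FDRep.of ρ) := by
  have : NeZero (Nat.card G : ℂ) := ⟨by exact_mod_cast Nat.card_pos.ne'⟩
  rw [FDRep.simple_iff_end_is_rank_one,
    ← (FDRep.forget₂HomLinearEquiv (FDRep.of ρ) (FDRep.of ρ)).finrank_eq,
    (Rep.homLinearEquiv _ _).finrank_eq]
  exact Representation.IsIrreducible.finrank_intertwiningMap_self ρ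

theorem Subrepresentation.isIrreducible_toRepresentation {k G V : Type*} [Field k] [Monoid G]
    [AddCommGroup V] [Module k V] {ρ : Representation k G V} (σ : Subrepresentation ρ)
    (hσ : σ.toSubmodule ≠ ⊥)
    (hmin : ∀ τ : Subrepresentation ρ, τ.toSubmodule ≠ ⊥ → τ.toSubmodule ≤ σ.toSubmodule →
      σ.toSubmodule ≤ τ.toSubmodule) :
    σ.toRepresentation.IsIrreducible := by
  have : Nontrivial σ.toSubmodule := Submodule.nontrivial_iff_ne_bot.2 hσ
  refine { exists_pair_ne := ⟨⊥, ⊤, fun h => ?_⟩, eq_bot_or_eq_top := fun τ => ?_ }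
  · obtain ⟨x, hx⟩ := exists_ne (0 : σ.toSubmodule)
    have : x ∈ (⊥ : Subrepresentation σ.toRepresentation) := h ▸ trivial
    exact hx this
  · by_cases hτ : τ.toSubmodule = ⊥
    · left
      exact Subrepresentation.toSubmodule_injective hτ
    · right
      apply Subrepresentation.toSubmodule_injective
      let τ' : Subrepresentation ρ :=
        { toSubmodule := τ.toSubmodule.map σ.toSubmodule.subtype
          apply_mem_toSubmodule := by
            rintro g _ ⟨x, hx, rfl⟩
            exact ⟨σ.toRepresentation g x, τ.apply_mem_toSubmodule g hx, rfl⟩ }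
      have h := hmin τ'
        (fun h => hτ <| Submodule.map_injective_of_injective σ.toSubmodule.injective_subtype <|
          h.trans (Submodule.map_bot _).symm)
        (Submodule.map_subtype_le _ _)
      refine eq_top_iff.2 fun x _ => ?_
      obtain ⟨y, hy, hyx⟩ := h x.2
      rwa [← Subtype.ext hyx]

theorem Subrepresentation.exists_isIrreducible_le {k G V : Type*} [Field k] [Monoid G]
    [AddCommGroup V] [Module k V] [FiniteDimensional k V] {ρ : Representation k G V}
    (σ : Subrepresentation ρ) (hσ : σ.toSubmodule ≠ ⊥) :
    ∃ τ : Subrepresentation ρ, τ.toSubmodule ≠ ⊥ ∧ τ.toSubmodule ≤ σ.toSubmodule ∧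
      τ.toRepresentation.IsIrreducible := by
  obtain ⟨M, hMσ, hM⟩ := exists_minimal_le_of_wellFoundedLT
    (fun M : Submodule k V => M ≠ ⊥ ∧ ∃ τ : Subrepresentation ρ, τ.toSubmodule = M)
    σ.toSubmodule ⟨hσ, σ, rfl⟩
  obtain ⟨hM0, τ, rfl⟩ := hM.prop
  exact ⟨τ, hM0, hMσ, τ.isIrreducible_toRepresentation hM0
    fun τ' h h' => hM.le_of_le ⟨h, τ', rfl⟩ h'⟩

section Quasirandom

variable {G : Type} [Group G] [Fintype G]

/-- The right regular representation on complex functions on a finite group. -/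
noncomputable def rightRegular (G : Type) [Group G] [Fintype G] :
    Representation ℂ G (EuclideanSpace ℂ G) where
  toFun g :=
    { toFun := fun f => WithLp.toLp 2 fun x => f (x * g)
      map_add' := fun _ _ => rfl
      map_smul' := fun _ _ => rfl }
  map_one' := by ext f x; simp
  map_mul' g h := by ext f x; exact congrArg f (mul_assoc x g h).symm

@[simp]
theorem rightRegular_apply (g : G) (f : EuclideanSpace ℂ G) (x : G) :
    rightRegular G g f x = f (x * g) := rfl

/-- Left convolution by `X`, as a linear operator on complex functions on a finite group. -/
noncomputable def leftConv (X : G → ℂ) : EuclideanSpace ℂ G →ₗ[ℂ] EuclideanSpace ℂ G where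
  toFun f := WithLp.toLp 2 fun x => ∑ y, X y * f (y⁻¹ * x)
  map_add' f h := by ext x; simp [mul_add, Finset.sum_add_distrib]
  map_smul' c f := by
    ext x
    simp only [PiLp.smul_apply, smul_eq_mul, Finset.mul_sum, RingHom.id_apply]
    exact Finset.sum_congr rfl fun y _ => by ring

theorem leftConv_apply (X : G → ℂ) (f : EuclideanSpace ℂ G) (x : G) :
    leftConv X f x = ∑ y, X y * f (y⁻¹ * x) := rfl

theorem leftConv_rightRegular (X : G → ℂ) (g : G) (f : EuclideanSpace ℂ G) :
    leftConv X (rightRegular G g f) = rightRegular G g (leftConv X f) := by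
  ext x
  simp [leftConv_apply, mul_assoc]

theorem inner_leftConv_left (X : G → ℂ) (f h : EuclideanSpace ℂ G) :
    inner ℂ (leftConv X f) h = inner ℂ f (leftConv (fun y => star (X y⁻¹)) h) := by
  simp only [PiLp.inner_apply, leftConv_apply, RCLike.inner_apply, map_sum, map_mul,
    Finset.mul_sum, Finset.sum_mul]
  calc ∑ x, ∑ y, h x * ((starRingEnd ℂ) (X y) * (starRingEnd ℂ) (f (y⁻¹ * x)))
      = ∑ y, ∑ x, h (y * x) * ((starRingEnd ℂ) (X y) * (starRingEnd ℂ) (f x)) := by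
        rw [Finset.sum_comm]
        refine Finset.sum_congr rfl fun y _ => ?_
        rw [← Equiv.sum_comp (Equiv.mulLeft y)]
        simp
    _ = ∑ y, ∑ x, h (y⁻¹ * x) * ((starRingEnd ℂ) (X y⁻¹) * (starRingEnd ℂ) (f x)) :=
        (Equiv.sum_comp (Equiv.inv G) _).symm
    _ = _ := by
        rw [Finset.sum_comm]
        refine Finset.sum_congr rfl fun x _ => Finset.sum_congr rfl fun y _ => ?_
        simp
        ring

open Classical in
/-- The functions whose sum over every fibre of `G → Gᵃᵇ` vanishes, as a subrepresentation of
the right regular representation. -/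
noncomputable def abelianizationNull (G : Type) [Group G] [Fintype G] :
    Subrepresentation (rightRegular G) where
  toSubmodule :=
    { carrier := {f | ∀ x : G,
        ∑ z, (if Abelianization.of z = Abelianization.of x then f z else 0) = 0}
      zero_mem' := by simp
      add_mem' := fun {f f'} hf hf' x => by
        have := congrArg₂ (· + ·) (hf x) (hf' x)
        simp only [← Finset.sum_add_distrib, add_zero] at this
        refine (Finset.sum_congr rfl fun z _ => ?_).trans this
        split_ifs <;> simp
      smul_mem' := fun c f hf x => by
        have := congrArg (c * ·) (hf x)
        simp only [Finset.mul_sum, mul_zero, mul_ite] at this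
        exact this }
  apply_mem_toSubmodule g f hf x := by
    refine Eq.trans ?_ ((Equiv.sum_comp (Equiv.mulRight g) _).trans (hf (x * g)))
    simp

open Classical in
theorem mem_abelianizationNull {f : EuclideanSpace ℂ G} :
    f ∈ (abelianizationNull G).toSubmodule ↔
      ∀ x : G, ∑ z, (if Abelianization.of z = Abelianization.of x then f z else 0) = 0 :=
  Iff.rfl

theorem leftConv_mem_abelianizationNull (X : G → ℂ) {f : EuclideanSpace ℂ G}
    (hf : f ∈ (abelianizationNull G).toSubmodule) :
    leftConv X f ∈ (abelianizationNull G).toSubmodule := by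
  classical
  rw [mem_abelianizationNull] at hf ⊢
  intro x
  calc _ = ∑ z, ∑ y, X y *
        (if Abelianization.of z = Abelianization.of x then f (y⁻¹ * z) else 0) := by
        refine Finset.sum_congr rfl fun z _ => ?_
        split_ifs <;> simp [leftConv_apply]
    _ = ∑ y, X y *
        ∑ z, (if Abelianization.of z = Abelianization.of (y⁻¹ * x) then f z else 0) := by
        rw [Finset.sum_comm]
        refine Finset.sum_congr rfl fun y _ => ?_
        rw [Finset.mul_sum, ← Equiv.sum_comp (Equiv.mulLeft y)]
        simp [eq_inv_mul_iff_mul_eq]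
    _ = 0 := by simp only [hf, mul_zero, Finset.sum_const_zero]

theorem rightRegular_apply_eq_self_of_mem_commutator {f : EuclideanSpace ℂ G}
    (hf : ∀ g, ∃ c : ℂ, rightRegular G g f = c • f) {h : G} (hh : h ∈ commutator G) :
    rightRegular G h f = f := by
  have hcomm : ∀ a b, rightRegular G (a * b) f = rightRegular G (b * a) f := fun a b => by
    obtain ⟨c, hc⟩ := hf a
    obtain ⟨d, hd⟩ := hf b
    simp [map_mul, hc, hd, smul_smul, mul_comm]
  let K : Subgroup G :=
    { carrier := {h | rightRegular G h f = f}
      one_mem' := by simp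
      mul_mem' := fun {a b} ha hb => by
        rw [Set.mem_ofPred_eq] at *
        rw [map_mul, Module.End.mul_apply, hb, ha]
      inv_mem' := fun {a} ha => by
        rw [Set.mem_ofPred_eq] at *
        nth_rw 1 [← ha]
        rw [← Module.End.mul_apply, ← map_mul]
        simp }
  suffices commutator G ≤ K from this hh
  rw [commutator_def, Subgroup.commutator_le]
  rintro a - b -
  obtain ⟨c, hc⟩ := hf (b * a)⁻¹
  change rightRegular G (a * b * a⁻¹ * b⁻¹) f = f
  rw [show a * b * a⁻¹ * b⁻¹ = (a * b) * (b * a)⁻¹ by group, map_mul, Module.End.mul_apply, hc,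
    map_smul, hcomm, ← map_smul, ← hc, ← Module.End.mul_apply, ← map_mul]
  simp

theorem one_lt_finrank_of_le_abelianizationNull (V : Subrepresentation (rightRegular G))
    (hV : V.toSubmodule ≠ ⊥) (hle : V.toSubmodule ≤ (abelianizationNull G).toSubmodule) :
    1 < Module.finrank ℂ V.toSubmodule := by
  classical
  by_contra! hd
  obtain ⟨⟨f, hfV⟩, hf⟩ := finrank_le_one_iff.1 hd
  refine hV ((Submodule.eq_bot_iff _).2 fun f' hf' => ?_)
  have hsmul : ∀ v ∈ V.toSubmodule, ∃ c : ℂ, v = c • f := fun v hv => by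
    obtain ⟨c, hc⟩ := hf ⟨v, hv⟩
    exact ⟨c, (congrArg Subtype.val hc).symm⟩
  have hinv : ∀ x z, Abelianization.of z = Abelianization.of x → f z = f x := fun x z hxz => by
    have hmem : x⁻¹ * z ∈ commutator G := by
      rw [← Abelianization.ker_of, MonoidHom.mem_ker, map_mul, map_inv, hxz, inv_mul_cancel]
    have := congrArg (fun u : EuclideanSpace ℂ G => u x)
      (rightRegular_apply_eq_self_of_mem_commutator
        (fun g => hsmul _ (V.apply_mem_toSubmodule g hfV)) hmem)
    simpa using this
  have hf0 : f = 0 := by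
    ext x
    have := mem_abelianizationNull.1 (hle hfV) x
    have h2 : ∑ z, (if Abelianization.of z = Abelianization.of x then f z else 0) =
        ∑ z, (if Abelianization.of z = Abelianization.of x then f x else 0) :=
      Finset.sum_congr rfl fun z _ => by
        split_ifs with h
        · exact hinv x z h
        · rfl
    rw [h2, ← Finset.sum_filter, Finset.sum_const, smul_eq_zero, Finset.card_eq_zero] at this
    refine this.resolve_left (Finset.Nonempty.ne_empty ⟨x, by simp⟩)
  obtain ⟨c, rfl⟩ := hsmul f' hf'
  simp [hf0]

theorem minNontrivIrrepDim_le_finrank (V : Subrepresentation (rightRegular G))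
    (hV : V.toSubmodule ≠ ⊥) (hle : V.toSubmodule ≤ (abelianizationNull G).toSubmodule) :
    minNontrivIrrepDim G ≤ Module.finrank ℂ V.toSubmodule := by
  obtain ⟨τ, hτ, hτV, hirr⟩ := V.exists_isIrreducible_le hV
  refine le_trans (Nat.sInf_le ?_) (Submodule.finrank_mono hτV)
  exact ⟨one_lt_finrank_of_le_abelianizationNull τ hτ (hτV.trans hle), FDRep.of τ.toRepresentation,
    FDRep.simple_of_isIrreducible _, rfl⟩

/-- The Hilbert–Schmidt bound for left convolution. -/
theorem sum_norm_leftConv_sq_le {ι : Type*} [Fintype ι] {b : ι → EuclideanSpace ℂ G}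
    (hb : Orthonormal ℂ b) (X : G → ℂ) :
    ∑ i, ‖leftConv X (b i)‖ ^ 2 ≤ Fintype.card G * ∑ y, ‖X y‖ ^ 2 := by
  let r : G → EuclideanSpace ℂ G := fun x => WithLp.toLp 2 fun z => star (X (x * z⁻¹))
  have hr : ∀ x, ‖r x‖ ^ 2 = ∑ y, ‖X y‖ ^ 2 := fun x => by
    rw [EuclideanSpace.norm_sq_eq,
      ← Equiv.sum_comp ((Equiv.inv G).trans (Equiv.mulLeft x)) fun y => ‖X y‖ ^ 2]
    simp [r]
  have happ : ∀ f x, leftConv X f x = inner ℂ (r x) f := fun f x => by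
    rw [leftConv_apply, PiLp.inner_apply,
      ← Equiv.sum_comp ((Equiv.inv G).trans (Equiv.mulLeft x))]
    simp [r, mul_comm]
  calc ∑ i, ‖leftConv X (b i)‖ ^ 2 = ∑ x, ∑ i, ‖inner ℂ (b i) (r x)‖ ^ 2 := by
        rw [Finset.sum_comm]
        refine Finset.sum_congr rfl fun i _ => ?_
        rw [EuclideanSpace.norm_sq_eq]
        simp_rw [happ, norm_inner_symm]
    _ ≤ ∑ x, ‖r x‖ ^ 2 := Finset.sum_le_sum fun x _ => hb.sum_inner_products_le _
    _ = _ := by simp [hr]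

theorem norm_leftConv_sq_le (X : G → ℂ) {f : EuclideanSpace ℂ G}
    (hf : f ∈ (abelianizationNull G).toSubmodule) :
    minNontrivIrrepDim G * ‖leftConv X f‖ ^ 2 ≤
      (Fintype.card G * ∑ y, ‖X y‖ ^ 2) * ‖f‖ ^ 2 := by
  obtain rfl | hf0 := eq_or_ne f 0
  · simp
  set W := (abelianizationNull G).toSubmodule
  let A : Module.End ℂ (EuclideanSpace ℂ G) := leftConv (fun y => star (X y⁻¹)) ∘ₗ leftConv X
  have hAW : ∀ v ∈ W, A v ∈ W := fun v hv =>
    leftConv_mem_abelianizationNull _ (leftConv_mem_abelianizationNull _ hv)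
  have hA : ∀ v w, inner ℂ (A v) w = inner ℂ (leftConv X v) (leftConv X w) := fun v w => by
    change inner ℂ (leftConv (fun y => star (X y⁻¹)) (leftConv X v)) w = _
    rw [inner_leftConv_left]
    simp only [inv_inv, star_star]
  have hsym : A.IsSymmetric := fun v w => by
    rw [hA, ← inner_conj_symm v, hA, inner_conj_symm]
  have hre : ∀ v, RCLike.re (inner ℂ (A v) v) = ‖leftConv X v‖ ^ 2 := fun v => by
    rw [hA, inner_self_eq_norm_sq]
  have : Nontrivial W := ⟨⟨f, hf⟩, 0, fun h => hf0 (congrArg Subtype.val h)⟩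
  have hsymW := hsym.restrict_invariant hAW
  have hev := hsymW.hasEigenvalue_iSup_of_finiteDimensional
  set μ : ℝ := ⨆ x : { x : W // x ≠ 0 },
    RCLike.re (inner ℂ (A.restrict hAW x) (x : W)) / ‖(x : W)‖ ^ 2 with hμ
  have hfμ : ‖leftConv X f‖ ^ 2 ≤ μ * ‖f‖ ^ 2 := by
    have hbdd : BddAbove (Set.range fun x : { x : W // x ≠ 0 } =>
        RCLike.re (inner ℂ (A.restrict hAW x) (x : W)) / ‖(x : W)‖ ^ 2) := by
      refine ⟨‖(leftConv X).toContinuousLinearMap‖ ^ 2, ?_⟩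
      rintro _ ⟨⟨x, hx⟩, rfl⟩
      have hx' : 0 < ‖x‖ := norm_pos_iff.2 hx
      change RCLike.re (inner ℂ (A x) (x : EuclideanSpace ℂ G)) / ‖x‖ ^ 2 ≤ _
      rw [hre, div_le_iff₀ (by positivity), ← mul_pow]
      gcongr
      exact (leftConv X).toContinuousLinearMap.le_opNorm x
    have := le_ciSup hbdd ⟨⟨f, hf⟩, fun h => hf0 (congrArg Subtype.val h)⟩
    rw [← hμ] at this
    change RCLike.re (inner ℂ (A f) f) / ‖f‖ ^ 2 ≤ μ at this
    have hf' : 0 < ‖f‖ := norm_pos_iff.2 hf0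
    rwa [hre, div_le_iff₀ (by positivity)] at this
  let F : Subrepresentation (rightRegular G) :=
    { toSubmodule := W ⊓ A.eigenspace (μ : ℂ)
      apply_mem_toSubmodule := fun g v hv => by
        refine ⟨(abelianizationNull G).apply_mem_toSubmodule g hv.1, ?_⟩
        have := Module.End.mem_eigenspace_iff.1 hv.2
        refine Module.End.mem_eigenspace_iff.2 ?_
        rw [← map_smul, ← this]
        simp [A, leftConv_rightRegular] }
  have hF0 : F.toSubmodule ≠ ⊥ := by
    obtain ⟨v, hv⟩ := hev.exists_hasEigenvector
    refine (Submodule.ne_bot_iff _).2 ⟨v, ⟨v.2, ?_⟩, fun h => hv.2 (Subtype.ext h)⟩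
    exact Module.End.mem_eigenspace_iff.2 (congrArg Subtype.val hv.apply_eq_smul)
  have hn := minNontrivIrrepDim_le_finrank F hF0 inf_le_left
  have hd := one_lt_finrank_of_le_abelianizationNull F hF0 inf_le_left
  set d := Module.finrank ℂ F.toSubmodule
  let b := stdOrthonormalBasis ℂ F.toSubmodule
  have hb : Orthonormal ℂ fun i => (b i : EuclideanSpace ℂ G) :=
    b.orthonormal.comp_linearIsometry F.toSubmodule.subtypeₗᵢ
  have hbn : ∀ i, ‖leftConv X (b i)‖ ^ 2 = μ := fun i => by
    rw [← hre, Module.End.mem_eigenspace_iff.1 (b i).2.2, inner_smul_left,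
      inner_self_eq_norm_sq_to_K]
    have : ‖(b i : EuclideanSpace ℂ G)‖ = 1 := hb.1 i
    simp [this]
  have hdμ := sum_norm_leftConv_sq_le hb X
  simp only [hbn, Finset.sum_const, Finset.card_univ, Fintype.card_fin, nsmul_eq_mul] at hdμ
  have hμ0 : 0 ≤ μ := by
    rw [← hbn ⟨0, by omega⟩]; positivity
  calc minNontrivIrrepDim G * ‖leftConv X f‖ ^ 2 ≤ d * (μ * ‖f‖ ^ 2) := by gcongr
    _ = (d * μ) * ‖f‖ ^ 2 := by ring
    _ ≤ _ := by gcongr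

end Quasirandom
section Projection

variable {G : Type} [Group G] [Fintype G]

open Classical in
/-- The size of the fibres of `G → Gᵃᵇ`. -/
noncomputable def abelianizationFiberCard (G : Type) [Group G] [Fintype G] : ℕ :=
  (Finset.univ.filter fun z : G => Abelianization.of z = 1).card

open Classical in
theorem card_filter_abelianization_eq (x : G) :
    (Finset.univ.filter fun z : G => Abelianization.of z = Abelianization.of x).card =
      abelianizationFiberCard G := by
  refine Finset.card_equiv (Equiv.mulRight x⁻¹) fun z => ?_
  simp [mul_inv_eq_one]

theorem abelianizationFiberCard_pos : 0 < abelianizationFiberCard G := by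
  classical
  exact Finset.card_pos.2 ⟨1, by simp⟩

theorem abelianizationFiberCard_mul_card [Fintype (Abelianization G)] :
    abelianizationFiberCard G * Fintype.card (Abelianization G) = Fintype.card G := by
  classical
  have h := Finset.card_eq_sum_card_fiberwise (s := (Finset.univ : Finset G))
    (f := Abelianization.of) (t := Finset.univ) (fun _ _ => by simp)
  rw [Finset.card_univ] at h
  rw [h, Finset.sum_congr rfl (g := fun _ => abelianizationFiberCard G), Finset.sum_const,
    Finset.card_univ, smul_eq_mul, mul_comm]
  intro a _
  obtain ⟨x, rfl⟩ := QuotientGroup.mk_surjective a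
  exact card_filter_abelianization_eq x

open Classical in
/-- The average of a function over the fibres of `G → Gᵃᵇ`. -/
noncomputable def abelianizationAvg (f : EuclideanSpace ℂ G) : EuclideanSpace ℂ G :=
  WithLp.toLp 2 fun x =>
    (∑ z, if Abelianization.of z = Abelianization.of x then f z else 0) / abelianizationFiberCard G

open Classical in
theorem abelianizationAvg_apply (f : EuclideanSpace ℂ G) (x : G) :
    abelianizationAvg f x =
      (∑ z, if Abelianization.of z = Abelianization.of x then f z else 0) /
        abelianizationFiberCard G := rfl

theorem sub_abelianizationAvg_mem (f : EuclideanSpace ℂ G) :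
    f - abelianizationAvg f ∈ (abelianizationNull G).toSubmodule := by
  classical
  rw [mem_abelianizationNull]
  intro x
  have hk : (abelianizationFiberCard G : ℂ) ≠ 0 := by
    exact_mod_cast abelianizationFiberCard_pos.ne'
  have h : ∑ z, (if Abelianization.of z = Abelianization.of x then abelianizationAvg f z else 0) =
      ∑ z, (if Abelianization.of z = Abelianization.of x then abelianizationAvg f x else 0) := by
    refine Finset.sum_congr rfl fun z _ => ?_
    split_ifs with hz
    · simp [abelianizationAvg_apply, hz]
    · rfl
  have hsub : ∀ z, (if Abelianization.of z = Abelianization.of x then (f - abelianizationAvg f) z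
      else 0) = (if Abelianization.of z = Abelianization.of x then f z else 0) -
        if Abelianization.of z = Abelianization.of x then abelianizationAvg f z else 0 := fun z => by
    split_ifs <;> simp
  simp_rw [hsub, Finset.sum_sub_distrib]
  rw [h, ← Finset.sum_filter (f := fun _ => abelianizationAvg f x), Finset.sum_const,
    card_filter_abelianization_eq, abelianizationAvg_apply, nsmul_eq_mul, mul_div_cancel₀ _ hk,
    sub_self]

theorem inner_abelianizationAvg_eq_zero (f : EuclideanSpace ℂ G) {h : EuclideanSpace ℂ G}
    (hh : h ∈ (abelianizationNull G).toSubmodule) : inner ℂ (abelianizationAvg f) h = 0 := by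
  classical
  rw [mem_abelianizationNull] at hh
  calc inner ℂ (abelianizationAvg f) h
      = ∑ x, ∑ z, (starRingEnd ℂ) (f z) / abelianizationFiberCard G *
          (if Abelianization.of x = Abelianization.of z then h x else 0) := by
        simp only [PiLp.inner_apply, RCLike.inner_apply, abelianizationAvg_apply, map_div₀, map_sum,
          map_natCast, Finset.sum_div, Finset.mul_sum]
        refine Finset.sum_congr rfl fun x _ => Finset.sum_congr rfl fun z _ => ?_
        by_cases hxz : Abelianization.of z = Abelianization.of x
        · simp [hxz, mul_comm]
        · simp [hxz, Ne.symm hxz]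
    _ = 0 := by
        rw [Finset.sum_comm]
        simp only [← Finset.mul_sum, hh, mul_zero, Finset.sum_const_zero]

theorem norm_sub_abelianizationAvg_le (f : EuclideanSpace ℂ G) :
    ‖f - abelianizationAvg f‖ ≤ ‖f‖ := by
  have h := norm_add_sq_eq_norm_sq_add_norm_sq_of_inner_eq_zero _ _
    (inner_abelianizationAvg_eq_zero f (sub_abelianizationAvg_mem f))
  rw [add_sub_cancel] at h
  nlinarith [norm_nonneg f, norm_nonneg (f - abelianizationAvg f), norm_nonneg (abelianizationAvg f)]

end Projection

section TripleProduct

variable {G : Type} [Group G] [Fintype G]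

omit [Fintype G] in
theorem TripleProductProperty.eq_of_mul_eq_one {S T U : Set G} (h : TripleProductProperty S T U)
    {s s' t t' u u' : G} (hs : s ∈ S) (hs' : s' ∈ S) (ht : t ∈ T) (ht' : t' ∈ T) (hu : u ∈ U)
    (hu' : u' ∈ U) (heq : s * s'⁻¹ * (t * t'⁻¹) * (u * u'⁻¹) = 1) : s = s' ∧ t = t' ∧ u = u' := by
  simpa [mul_inv_eq_one] using
    h _ ⟨s, hs, s', hs', rfl⟩ _ ⟨t, ht, t', ht', rfl⟩ _ ⟨u, hu, u', hu', rfl⟩ heq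

open Classical in
/-- The indicator function of a finite set. -/
noncomputable def indicatorVec (D : Finset G) : EuclideanSpace ℂ G :=
  WithLp.toLp 2 fun g => if g ∈ D then 1 else 0

omit [Group G] in
theorem sum_norm_indicatorVec_sq (D : Finset G) : ∑ g, ‖indicatorVec D g‖ ^ 2 = D.card := by
  classical
  have : ∀ g, ‖indicatorVec D g‖ ^ 2 = if g ∈ D then 1 else 0 := fun g => by
    by_cases hg : g ∈ D <;> simp [indicatorVec, hg]
  simp [this]

omit [Group G] in
theorem norm_indicatorVec_sq (D : Finset G) : ‖indicatorVec D‖ ^ 2 = D.card := by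
  rw [EuclideanSpace.norm_sq_eq, sum_norm_indicatorVec_sq]

theorem inner_indicatorVec_leftConv (X Z : Finset G) (f : EuclideanSpace ℂ G) :
    inner ℂ (indicatorVec Z) (leftConv (indicatorVec X) f) = ∑ z ∈ Z, ∑ x ∈ X, f (x⁻¹ * z) := by
  classical
  simp only [PiLp.inner_apply, RCLike.inner_apply, leftConv_apply]
  simp [indicatorVec]

open Classical in
/-- The set `A⁻¹B`. -/
noncomputable def invMulSet (A B : Finset G) : Finset G :=
  (A ×ˢ B).image fun p => p.1⁻¹ * p.2

omit [Fintype G] in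
theorem sum_invMulSet {M : Type*} [AddCommMonoid M] {A B : Finset G}
    (h : Set.InjOn (fun p : G × G => p.1⁻¹ * p.2) (A ×ˢ B : Finset (G × G))) (f : G → M) :
    ∑ x ∈ invMulSet A B, f x = ∑ p ∈ A ×ˢ B, f (p.1⁻¹ * p.2) := by
  classical
  exact Finset.sum_image h

omit [Fintype G] in
theorem card_invMulSet {A B : Finset G}
    (h : Set.InjOn (fun p : G × G => p.1⁻¹ * p.2) (A ×ˢ B : Finset (G × G))) :
    (invMulSet A B).card = A.card * B.card := by
  classical
  rw [invMulSet, Finset.card_image_of_injOn h, Finset.card_product]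

open Classical in
theorem sq_card_le_card_mul_card_collisions {α β : Type*} [Fintype β] (P : Finset α) (ψ : α → β) :
    P.card ^ 2 ≤ Fintype.card β * ((P ×ˢ P).filter fun p => ψ p.1 = ψ p.2).card := by
  have h1 : P.card = ∑ a, (P.filter fun p => ψ p = a).card :=
    Finset.card_eq_sum_card_fiberwise fun _ _ => by simp
  have h2 : ((P ×ˢ P).filter fun p => ψ p.1 = ψ p.2).card =
      ∑ a, (P.filter fun p => ψ p = a).card ^ 2 := by
    rw [Finset.card_eq_sum_card_fiberwise (f := fun p => ψ p.1) (t := Finset.univ)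
      fun _ _ => by simp]
    refine Finset.sum_congr rfl fun a _ => ?_
    rw [sq, ← Finset.card_product]
    congr 1
    ext ⟨p, q⟩
    simp
    grind
  rw [h1, h2]
  exact sq_sum_le_card_mul_sum_sq

theorem inv_mul_eq_inv_mul_inv_mul_iff {A : Type*} [CommGroup A] (s s' t t' u u' : A) :
    t'⁻¹ * u' = (s⁻¹ * t)⁻¹ * (s'⁻¹ * u) ↔ s * t' * u = s' * t * u' := by
  have h1 : s' * t * t' * (t'⁻¹ * u') = s' * t * u' := by group
  have h2 : s' * t * t' * ((s⁻¹ * t)⁻¹ * (s'⁻¹ * u)) = s * t' * u := by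
    rw [mul_inv, inv_inv]
    calc _ = (s' * s'⁻¹) * (t * t⁻¹) * (s * t' * u) := by ac_rfl
      _ = _ := by simp
  rw [← mul_right_inj (s' * t * t'), h1, h2, eq_comm]

theorem TripleProductProperty.card_le {S T U : Finset G}
    (h : TripleProductProperty (S : Set G) T U) (hn : 0 < minNontrivIrrepDim G) :
    ((S.card * T.card * U.card : ℕ) : ℝ) ≤
      Fintype.card G * (1 + √(Fintype.card G / minNontrivIrrepDim G)) := by
  classical
  have : Fintype (Abelianization G) := Fintype.ofFinite _
  obtain h0 | h0 := Nat.eq_zero_or_pos (S.card * T.card * U.card)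
  · rw [h0]; simp only [Nat.cast_zero]; positivity
  obtain ⟨⟨hS, hT⟩, hU⟩ : (0 < S.card ∧ 0 < T.card) ∧ 0 < U.card := by
    simpa [Nat.pos_iff_ne_zero, mul_eq_zero, not_or] using h0
  obtain ⟨s₀, hs₀⟩ := Finset.card_pos.1 hS
  obtain ⟨t₀, ht₀⟩ := Finset.card_pos.1 hT
  obtain ⟨u₀, hu₀⟩ := Finset.card_pos.1 hU
  have hST : Set.InjOn (fun p : G × G => p.1⁻¹ * p.2) (S ×ˢ T : Finset (G × G)) := by
    rintro ⟨s, t⟩ hst ⟨s', t'⟩ hst' heq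
    simp only [Finset.coe_product, Set.mem_prod, Finset.mem_coe] at hst hst' heq
    have := h.eq_of_mul_eq_one hst'.1 hst.1 hst.2 hst'.2 hu₀ hu₀
      (by simp only [mul_assoc, ← mul_assoc s⁻¹ t, heq]; simp)
    simp [this]
  have hTU : Set.InjOn (fun p : G × G => p.1⁻¹ * p.2) (T ×ˢ U : Finset (G × G)) := by
    rintro ⟨t, u⟩ htu ⟨t', u'⟩ htu' heq
    simp only [Finset.coe_product, Set.mem_prod, Finset.mem_coe] at htu htu' heq
    have := h.eq_of_mul_eq_one hs₀ hs₀ htu'.1 htu.1 htu.2 htu'.2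
      (by simp only [mul_assoc, ← mul_assoc t⁻¹ u, heq]; simp)
    simp [this]
  have hSU : Set.InjOn (fun p : G × G => p.1⁻¹ * p.2) (S ×ˢ U : Finset (G × G)) := by
    rintro ⟨s, u⟩ hsu ⟨s', u'⟩ hsu' heq
    simp only [Finset.coe_product, Set.mem_prod, Finset.mem_coe] at hsu hsu' heq
    have := h.eq_of_mul_eq_one hsu'.1 hsu.1 ht₀ ht₀ hsu.2 hsu'.2
      (by simp only [mul_assoc, mul_inv_cancel, mul_one, ← mul_assoc s⁻¹ u, heq])
    simp [this]
  set X := indicatorVec (invMulSet S T)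
  set Y := indicatorVec (invMulSet T U)
  set Z := indicatorVec (invMulSet S U)
  set k := abelianizationFiberCard G
  set n := minNontrivIrrepDim G
  have hk : 0 < k := abelianizationFiberCard_pos
  have hY : inner ℂ Z (leftConv X Y) = ((S.card * T.card * U.card : ℕ) : ℂ) := by
    rw [inner_indicatorVec_leftConv, sum_invMulSet hSU]
    simp_rw [sum_invMulSet hST]
    have hval : ∀ p ∈ S ×ˢ U, ∀ q ∈ S ×ˢ T,
        Y ((q.1⁻¹ * q.2)⁻¹ * (p.1⁻¹ * p.2)) = if q.1 = p.1 then 1 else 0 := by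
      rintro ⟨s', u⟩ hp ⟨s, t⟩ hq
      simp only [Finset.mem_product] at hp hq
      simp only [Y, indicatorVec, invMulSet, Finset.mem_image, Finset.mem_product, Prod.exists]
      refine if_congr ⟨?_, ?_⟩ rfl rfl
      · rintro ⟨t', u', ⟨ht', hu'⟩, heq⟩
        have heq' : u' = t' * ((s⁻¹ * t)⁻¹ * (s'⁻¹ * u)) := by rw [← heq]; group
        exact (h.eq_of_mul_eq_one hp.1 hq.1 hq.2 ht' hu' hp.2 (by rw [heq']; group)).1.symm
      · rintro rfl
        exact ⟨t, u, ⟨hq.2, hp.2⟩, by group⟩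
    rw [Finset.sum_congr rfl fun p hp => Finset.sum_congr rfl (hval p hp)]
    have hcount : ∀ p ∈ S ×ˢ U, ∑ q ∈ S ×ˢ T, (if q.1 = p.1 then (1 : ℂ) else 0) = T.card := by
      intro p hp
      rw [Finset.sum_product, Finset.sum_eq_single p.1]
      · simp
      · intro s _ hs
        simp [hs]
      · exact fun hp' => absurd (Finset.mem_product.1 hp).1 hp'
    rw [Finset.sum_congr rfl hcount, Finset.sum_const, Finset.card_product, nsmul_eq_mul]
    push_cast
    ring
  set P := S ×ˢ T ×ˢ U
  set ψ : G × G × G → Abelianization G := fun p =>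
    Abelianization.of p.1 * Abelianization.of p.2.1 * Abelianization.of p.2.2
  set N₆ := ((P ×ˢ P).filter fun p => ψ p.1 = ψ p.2).card
  have hY₀ : inner ℂ Z (leftConv X (abelianizationAvg Y)) = ((N₆ / k : ℝ) : ℂ) := by
    have hval : ∀ x, abelianizationAvg Y x = (∑ p ∈ T ×ˢ U,
        if Abelianization.of (p.1⁻¹ * p.2) = Abelianization.of x then 1 else 0) / k := fun x => by
      rw [← sum_invMulSet hTU
        fun y => if Abelianization.of y = Abelianization.of x then (1 : ℂ) else 0,
        abelianizationAvg_apply, ← Finset.sum_subset (Finset.subset_univ (invMulSet T U))]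
      · congr 1
        refine Finset.sum_congr rfl fun y hy => ?_
        simp [Y, indicatorVec, hy]
      · intro y _ hy
        simp [Y, indicatorVec, hy]
    rw [inner_indicatorVec_leftConv, sum_invMulSet hSU]
    simp_rw [sum_invMulSet hST, hval, ← Finset.sum_div]
    push_cast
    congr 1
    simp_rw [← Finset.sum_product']
    rw [Finset.natCast_card_filter]
    refine Finset.sum_nbij' (fun a => ((a.2.1.1, a.2.2.1, a.1.2), (a.1.1, a.2.1.2, a.2.2.2)))
      (fun b => ((b.2.1, b.1.2.2), ((b.1.1, b.2.2.1), (b.1.2.1, b.2.2.2)))) ?_ ?_ ?_ ?_ ?_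
    · simp [P]; tauto
    · simp [P]; tauto
    · simp
    · simp
    · rintro ⟨⟨s', u⟩, ⟨s, t⟩, ⟨t', u'⟩⟩ _
      simp only [ψ]
      refine if_congr ?_ rfl rfl
      simp only [map_mul, map_inv]
      exact inv_mul_eq_inv_mul_inv_mul_iff _ _ _ _ _ _
  have hY₁ : ‖inner ℂ Z (leftConv X (Y - abelianizationAvg Y))‖ ≤
      S.card * T.card * U.card * √(Fintype.card G / n) := by
    refine (norm_inner_le_norm _ _).trans (abs_le_of_sq_le_sq' ?_ (by positivity)).2
    rw [mul_pow, mul_pow, Real.sq_sqrt (by positivity), norm_indicatorVec_sq, card_invMulSet hSU]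
    have h1 := norm_leftConv_sq_le X (sub_abelianizationAvg_mem Y)
    rw [sum_norm_indicatorVec_sq, card_invMulSet hST] at h1
    have h2 : ‖Y - abelianizationAvg Y‖ ^ 2 ≤ (T.card * U.card : ℕ) := by
      rw [← card_invMulSet hTU, ← norm_indicatorVec_sq]
      gcongr
      exact norm_sub_abelianizationAvg_le Y
    have hn' : (0 : ℝ) < n := by exact_mod_cast hn
    have h3 : ‖leftConv X (Y - abelianizationAvg Y)‖ ^ 2 ≤
        Fintype.card G * (S.card * T.card : ℕ) * (T.card * U.card : ℕ) / n := by
      rw [le_div_iff₀ hn', mul_comm]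
      exact h1.trans (by gcongr)
    calc _ ≤ ((S.card * U.card : ℕ) : ℝ) *
          (Fintype.card G * (S.card * T.card : ℕ) * (T.card * U.card : ℕ) / n) := by gcongr
      _ = _ := by push_cast; ring
  rw [map_sub, inner_sub_right, hY, hY₀] at hY₁
  have hP : P.card = S.card * T.card * U.card := by simp [P, mul_assoc]
  have hCS := sq_card_le_card_mul_card_collisions P ψ
  rw [hP] at hCS
  set N := S.card * T.card * U.card with hN
  have hkm : k * Fintype.card (Abelianization G) = Fintype.card G :=
    abelianizationFiberCard_mul_card
  have hN0 : (0 : ℝ) < N := by exact_mod_cast h0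
  have hk0 : (0 : ℝ) < k := by exact_mod_cast hk
  have hCS' : (N : ℝ) ^ 2 ≤ Fintype.card G * (N₆ / k) := by
    rw [← hkm]
    calc (N : ℝ) ^ 2 ≤ Fintype.card (Abelianization G) * N₆ := by exact_mod_cast hCS
      _ = _ := by push_cast; field_simp
  have hdiff : (N₆ / k : ℝ) ≤ N * (1 + √(Fintype.card G / n)) := by
    rw [← Complex.ofReal_natCast, ← Complex.ofReal_sub, Complex.norm_real, Real.norm_eq_abs] at hY₁
    have := (abs_le.1 hY₁).1
    rw [hN] at this ⊢
    push_cast at this ⊢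
    linarith
  refine le_of_mul_le_mul_left ?_ hN0
  calc (N : ℝ) * N = N ^ 2 := by ring
    _ ≤ Fintype.card G * (N₆ / k) := hCS'
    _ ≤ Fintype.card G * (N * (1 + √(Fintype.card G / n))) := by gcongr
    _ = _ := by ring

end TripleProduct

theorem tripleProduct_card_le {G : Type} [Group G] [Fintype G] {c δ : ℝ} (hc : 0 < c)
    (hrep : c * (Fintype.card G : ℝ) ^ δ ≤ minNontrivIrrepDim G) {S T U : Set G}
    (h : TripleProductProperty S T U) :
    (S.ncard : ℝ) * T.ncard * U.ncard ≤
      Fintype.card G + (√c)⁻¹ * (Fintype.card G : ℝ) ^ (3 / 2 - δ / 2) := by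
  classical
  have hg : (0 : ℝ) < Fintype.card G := by exact_mod_cast Fintype.card_pos
  have hn : (0 : ℝ) < minNontrivIrrepDim G := lt_of_lt_of_le (by positivity) hrep
  have hle := TripleProductProperty.card_le (S := S.toFinset) (T := T.toFinset) (U := U.toFinset)
    (by simpa using h) (by exact_mod_cast hn)
  simp only [← Set.ncard_eq_toFinset_card'] at hle
  push_cast at hle
  set g : ℝ := (Fintype.card G : ℝ)
  calc _ ≤ g * (1 + √(g / minNontrivIrrepDim G)) := hle
    _ ≤ g * (1 + √(g / (c * g ^ δ))) := by gcongr
    _ = g + (√c)⁻¹ * (g * (g / g ^ δ) ^ (1 / 2 : ℝ)) := by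
        rw [← div_div, div_right_comm, Real.sqrt_div' _ hc.le, ← Real.sqrt_eq_rpow]
        ring
    _ = _ := by
        congr 2
        nth_rw 2 [← Real.rpow_one g]
        rw [← Real.rpow_sub hg, ← Real.rpow_mul hg.le]
        nth_rw 1 [← Real.rpow_one g]
        rw [← Real.rpow_add hg]
        congr 1
        ring

theorem stmt_11 (c δ : ℝ) (hc : 0 < c) (hδ : 0 < δ)
    (G : ℕ → Type) [∀ i, Group (G i)] [∀ i, Fintype (G i)]
    (hnonab : ∀ i, ∃ a b : G i, a * b ≠ b * a)
    (hcard : Filter.Tendsto (fun i => Fintype.card (G i)) Filter.atTop Filter.atTop)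
    (hrep : ∀ i, c * (Fintype.card (G i) : ℝ) ^ δ ≤ (minNontrivIrrepDim (G i) : ℝ))
    (S T U : ∀ i, Set (G i))
    (h : ∀ i, TripleProductProperty (S i) (T i) (U i)) :
    Filter.limsup
      (fun i =>
        Real.log (((S i).ncard : ℝ) * ((T i).ncard : ℝ) * ((U i).ncard : ℝ)) /
          Real.log (Fintype.card (G i)))
      Filter.atTop < 3 / 2 := by
  set ε : ℝ := min δ 1 / 2 with hε
  have hε0 : 0 < ε := by positivity
  have hε1 : ε ≤ 1 / 2 := by have := min_le_right δ 1; linarith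
  have hεδ : ε ≤ δ / 2 := by have := min_le_left δ 1; linarith
  have hlog : Filter.Tendsto (fun i => Real.log (Fintype.card (G i))) Filter.atTop Filter.atTop :=
    Real.tendsto_log_atTop.comp (tendsto_natCast_atTop_atTop.comp hcard)
  set C : ℝ := 1 + (√c)⁻¹ with hC
  have hC1 : 0 < C := by positivity
  have hev : ∀ᶠ i in Filter.atTop,
      Real.log (((S i).ncard : ℝ) * ((T i).ncard : ℝ) * ((U i).ncard : ℝ)) /
        Real.log (Fintype.card (G i)) ≤ 3 / 2 - ε / 2 := by
    filter_upwards [hlog.eventually_ge_atTop (Real.log C / (ε / 2)), hlog.eventually_gt_atTop 0]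
      with i hi hi0
    rw [div_le_iff₀ hi0]
    rw [div_le_iff₀ (by positivity)] at hi
    set g : ℝ := (Fintype.card (G i) : ℝ)
    have hg : 1 ≤ g := by
      have : 0 < Fintype.card (G i) := Fintype.card_pos
      exact Nat.one_le_cast.2 this
    have hb : ((S i).ncard : ℝ) * (T i).ncard * (U i).ncard ≤ C * g ^ (3 / 2 - ε) :=
      calc _ ≤ g + (√c)⁻¹ * g ^ (3 / 2 - δ / 2) := tripleProduct_card_le hc (hrep i) (h i)
        _ ≤ g ^ (3 / 2 - ε) + (√c)⁻¹ * g ^ (3 / 2 - ε) := by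
            gcongr
            · exact Real.self_le_rpow_of_one_le hg (by linarith)
        _ = _ := by ring
    obtain h0 | h0 := (show 0 ≤ ((S i).ncard : ℝ) * (T i).ncard * (U i).ncard by
      positivity).eq_or_lt
    · rw [← h0, Real.log_zero]
      exact mul_nonneg (by linarith) hi0.le
    · have := Real.log_le_log h0 hb
      rw [Real.log_mul hC1.ne' (by positivity), Real.log_rpow (by positivity)] at this
      linarith
  refine lt_of_le_of_lt (Filter.limsup_le_of_le ?_ hev) (by linarith)
  refine Filter.isCoboundedUnder_le_of_le _ (x := 0) fun i => ?_
  refine div_nonneg ?_ (Real.log_natCast_nonneg _)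
  exact_mod_cast Real.log_natCast_nonneg ((S i).ncard * (T i).ncard * (U i).ncard)
end

section
/- Let n ≥ 1, let D₁ = diag(x₁, …, xₙ) with x₁ > x₂ > ⋯ > xₙ > 0, and let D₂ = diag(y₁, …, yₙ) with 0 < y₁ < y₂ < ⋯ < yₙ. Suppose h ∈ O(n, ℝ), h₁ ∈ D₁·O(n, ℝ)·D₁⁻¹, and h₂ ∈ D₂·O(n, ℝ)·D₂⁻¹ satisfy h·h₁·h₂ = I. Then h, h₁, and h₂ are all diagonal matrices with all diagonal entries equal to ±1. In other words, the three conjugates O(n, ℝ), D₁·O(n, ℝ)·D₁⁻¹, D₂·O(n, ℝ)·D₂⁻¹ of O(n, ℝ) inside GL(n, ℝ) satisfy the K-triple product property where K is the subgroup of diagonal matrices with ±1 diagonal entries. -/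
open Matrix

lemma eq_one_or_neg_one_of_column {n : ℕ} {U : Matrix (Fin n) (Fin n) ℝ} (hU : Uᵀ * U = 1)
    {j : Fin n} (hj : ∀ k, k ≠ j → U k j = 0) : U j j = 1 ∨ U j j = -1 := by
  have h := congrFun (congrFun hU j) j
  rw [mul_apply, Finset.sum_eq_single j (fun k _ hk => by simp [hj k hk]) (by simp)] at h
  simpa [mul_self_eq_one_iff] using h

lemma apply_eq_zero_of_column {n : ℕ} {U : Matrix (Fin n) (Fin n) ℝ} (hU : Uᵀ * U = 1)
    {i j : Fin n} (hij : i ≠ j) (hi : ∀ k, k ≠ i → U k i = 0) : U i j = 0 := by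
  have h := congrFun (congrFun hU i) j
  rw [mul_apply, Finset.sum_eq_single i (fun k _ hk => by simp [hi k hk]) (by simp)] at h
  rw [transpose_apply, one_apply_ne hij] at h
  rcases eq_one_or_neg_one_of_column hU hi with h' | h' <;> simpa [h'] using h

lemma transpose_mul_self_apply_self {n : ℕ} (A : Matrix (Fin n) (Fin n) ℝ) (j : Fin n) :
    (Aᵀ * A) j j = ∑ k, A k j ^ 2 := by
  simp [mul_apply, sq]

lemma sum_sq_column {n : ℕ} {U : Matrix (Fin n) (Fin n) ℝ} (hU : Uᵀ * U = 1) (j : Fin n) :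
    ∑ k, U k j ^ 2 = 1 := by
  rw [← transpose_mul_self_apply_self, hU, one_apply_eq]

lemma diagonal_conj_apply {n : ℕ} {x : Fin n → ℝ} (hx : ∀ j, 0 < x j)
    (M : Matrix (Fin n) (Fin n) ℝ) (i j : Fin n) :
    (diagonal x * M * (diagonal x)⁻¹) i j = x i * M i j / x j := by
  have h : (diagonal x)⁻¹ = diagonal (fun j => (x j)⁻¹) := by
    apply inv_eq_right_inv
    rw [diagonal_mul_diagonal, ← diagonal_one]
    congr 1
    ext j
    exact mul_inv_cancel₀ (hx j).ne'
  rw [h, mul_diagonal, diagonal_mul, div_eq_mul_inv]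

/-- If the columns of two diagonal conjugates of orthogonal matrices, one by a decreasing and one
by an increasing diagonal, have the same norms, then both orthogonal matrices are diagonal. -/
lemma columns_eq_zero_of_sum_sq_eq {n : ℕ} {x y : Fin n → ℝ}
    (hx : StrictAnti x) (hxpos : ∀ j, 0 < x j) (hy : StrictMono y) (hypos : ∀ j, 0 < y j)
    {M N : Matrix (Fin n) (Fin n) ℝ} (hM : Mᵀ * M = 1) (hN : Nᵀ * N = 1)
    (hsum : ∀ j, ∑ k, (x k * M k j / x j) ^ 2 = ∑ k, (y k * N k j / y j) ^ 2) (j : Fin n) :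
    (∀ k, k ≠ j → M k j = 0) ∧ (∀ k, k ≠ j → N k j = 0) := by
  induction j using WellFoundedLT.induction with
  | ind j ih =>
    have hdM : ∑ k, ((x k * M k j / x j) ^ 2 - M k j ^ 2) =
        ∑ k, ((y k * N k j / y j) ^ 2 - N k j ^ 2) := by
      rw [Finset.sum_sub_distrib, Finset.sum_sub_distrib, sum_sq_column hM, sum_sq_column hN,
        hsum]
    have hMz : ∀ k, k < j → M k j = 0 := fun k hk =>
      apply_eq_zero_of_column hM hk.ne (ih k hk).1
    have hNz : ∀ k, k < j → N k j = 0 := fun k hk =>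
      apply_eq_zero_of_column hN hk.ne (ih k hk).2
    have eM : ∀ k, (x k * M k j / x j) ^ 2 - M k j ^ 2 = ((x k / x j) ^ 2 - 1) * M k j ^ 2 :=
      fun k => by ring
    have eN : ∀ k, (y k * N k j / y j) ^ 2 - N k j ^ 2 = ((y k / y j) ^ 2 - 1) * N k j ^ 2 :=
      fun k => by ring
    have ltM : ∀ k, j < k → (x k / x j) ^ 2 - 1 < 0 := fun k hk => by
      have := pow_lt_one₀ (div_pos (hxpos k) (hxpos j)).le
        ((div_lt_one (hxpos j)).2 (hx hk)) two_ne_zero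
      linarith
    have ltN : ∀ k, j < k → 0 < (y k / y j) ^ 2 - 1 := fun k hk => by
      have := one_lt_pow₀ ((one_lt_div (hypos j)).2 (hy hk)) two_ne_zero
      linarith
    simp only [eM, eN] at hdM
    have nonposM : ∀ k, ((x k / x j) ^ 2 - 1) * M k j ^ 2 ≤ 0 := fun k => by
      rcases lt_trichotomy k j with hk | rfl | hk
      · simp [hMz k hk]
      · simp [(hxpos k).ne']
      · exact mul_nonpos_of_nonpos_of_nonneg (ltM k hk).le (sq_nonneg _)
    have nonnegN : ∀ k, 0 ≤ ((y k / y j) ^ 2 - 1) * N k j ^ 2 := fun k => by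
      rcases lt_trichotomy k j with hk | rfl | hk
      · simp [hNz k hk]
      · simp [(hypos k).ne']
      · exact mul_nonneg (ltN k hk).le (sq_nonneg _)
    have sM := Finset.sum_nonpos fun k (_ : k ∈ Finset.univ) => nonposM k
    have sN := Finset.sum_nonneg fun k (_ : k ∈ Finset.univ) => nonnegN k
    have zM := (Finset.sum_eq_zero_iff_of_nonpos fun k _ => nonposM k).1
      (le_antisymm sM (hdM ▸ sN))
    have zN := (Finset.sum_eq_zero_iff_of_nonneg fun k _ => nonnegN k).1
      (le_antisymm (hdM ▸ sM) sN)
    refine ⟨fun k hk => ?_, fun k hk => ?_⟩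
    · rcases hk.lt_or_gt with hk | hk
      · exact hMz k hk
      · simpa [(ltM k hk).ne] using zM k (Finset.mem_univ k)
    · rcases hk.lt_or_gt with hk | hk
      · exact hNz k hk
      · simpa [(ltN k hk).ne'] using zN k (Finset.mem_univ k)

theorem stmt_16 (n : ℕ) (hn : 1 ≤ n) (x y : Fin n → ℝ)
    (hx : StrictAnti x) (hxpos : ∀ j, 0 < x j)
    (hy : StrictMono y) (hypos : ∀ j, 0 < y j)
    (h h₁ h₂ : Matrix (Fin n) (Fin n) ℝ)
    (hh : hᵀ * h = 1)
    (hh₁ : ∃ M₁ : Matrix (Fin n) (Fin n) ℝ, M₁ᵀ * M₁ = 1 ∧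
      h₁ = Matrix.diagonal x * M₁ * (Matrix.diagonal x)⁻¹)
    (hh₂ : ∃ M₂ : Matrix (Fin n) (Fin n) ℝ, M₂ᵀ * M₂ = 1 ∧
      h₂ = Matrix.diagonal y * M₂ * (Matrix.diagonal y)⁻¹)
    (hprod : h * h₁ * h₂ = 1) :
    (((∀ j k : Fin n, j ≠ k → h j k = 0) ∧ (∀ j : Fin n, h j j = 1 ∨ h j j = -1)) ∧
      ((∀ j k : Fin n, j ≠ k → h₁ j k = 0) ∧ (∀ j : Fin n, h₁ j j = 1 ∨ h₁ j j = -1))) ∧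
    ((∀ j k : Fin n, j ≠ k → h₂ j k = 0) ∧ (∀ j : Fin n, h₂ j j = 1 ∨ h₂ j j = -1)) := by
  obtain ⟨M, hM, rfl⟩ := hh₁
  obtain ⟨P, hP, rfl⟩ := hh₂
  have hP' : Pᵀᵀ * Pᵀ = 1 := by rw [transpose_transpose]; exact mul_eq_one_comm.1 hP
  have hyu : IsUnit (diagonal y).det := by
    rw [det_diagonal]
    exact (Finset.prod_pos fun j _ => hypos j).ne'.isUnit
  have hinv : h * (diagonal x * M * (diagonal x)⁻¹) = diagonal y * Pᵀ * (diagonal y)⁻¹ := by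
    refine left_inv_eq_right_inv hprod ?_
    calc diagonal y * P * (diagonal y)⁻¹ * (diagonal y * Pᵀ * (diagonal y)⁻¹)
        = diagonal y * (P * ((diagonal y)⁻¹ * diagonal y) * Pᵀ) * (diagonal y)⁻¹ := by
          simp only [Matrix.mul_assoc]
      _ = 1 := by
          rw [nonsing_inv_mul _ hyu, Matrix.mul_one, mul_eq_one_comm.1 hP, Matrix.mul_one,
            mul_nonsing_inv _ hyu]
  have hgram : (diagonal x * M * (diagonal x)⁻¹)ᵀ * (diagonal x * M * (diagonal x)⁻¹) =
      (diagonal y * Pᵀ * (diagonal y)⁻¹)ᵀ * (diagonal y * Pᵀ * (diagonal y)⁻¹) := by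
    rw [← hinv, transpose_mul h, Matrix.mul_assoc _ hᵀ, ← Matrix.mul_assoc hᵀ h, hh, Matrix.one_mul]
  have hcol := columns_eq_zero_of_sum_sq_eq hx hxpos hy hypos hM hP' fun j => by
    have := congrFun (congrFun hgram j) j
    simpa only [transpose_mul_self_apply_self, diagonal_conj_apply hxpos,
      diagonal_conj_apply hypos] using this
  have h₁off : ∀ j k, j ≠ k → (diagonal x * M * (diagonal x)⁻¹) j k = 0 := fun j k hjk => by
    simp [diagonal_conj_apply hxpos, (hcol k).1 j hjk]
  have h₂off : ∀ j k, j ≠ k → (diagonal y * P * (diagonal y)⁻¹) j k = 0 := fun j k hjk => by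
    have : P j k = 0 := (hcol j).2 k hjk.symm
    simp [diagonal_conj_apply hypos, this]
  have h₁diag : ∀ j, (diagonal x * M * (diagonal x)⁻¹) j j = 1 ∨
      (diagonal x * M * (diagonal x)⁻¹) j j = -1 := fun j => by
    rw [diagonal_conj_apply hxpos, mul_div_cancel_left₀ _ (hxpos j).ne']
    exact eq_one_or_neg_one_of_column hM (hcol j).1
  have h₂diag : ∀ j, (diagonal y * P * (diagonal y)⁻¹) j j = 1 ∨
      (diagonal y * P * (diagonal y)⁻¹) j j = -1 := fun j => by
    rw [diagonal_conj_apply hypos, mul_div_cancel_left₀ _ (hypos j).ne']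
    exact eq_one_or_neg_one_of_column hP' (hcol j).2
  refine ⟨⟨?_, h₁off, h₁diag⟩, h₂off, h₂diag⟩
  generalize diagonal x * M * (diagonal x)⁻¹ = A at *
  generalize diagonal y * P * (diagonal y)⁻¹ = B at *
  have hentry : ∀ j k, h j k * A k k * B k k = (1 : Matrix (Fin n) (Fin n) ℝ) j k := by
    intro j k
    rw [← hprod, mul_apply, Finset.sum_eq_single k (fun l _ hl => by simp [h₂off l k hl]) (by simp),
      mul_apply, Finset.sum_eq_single k (fun l _ hl => by simp [h₁off l k hl]) (by simp)]
  refine ⟨fun j k hjk => ?_, fun j => ?_⟩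
  · have := hentry j k
    rw [one_apply_ne hjk] at this
    rcases h₁diag k with h1 | h1 <;> rcases h₂diag k with h2 | h2 <;> simpa [h1, h2] using this
  · have := hentry j j
    rw [one_apply_eq] at this
    rcases h₁diag j with h1 | h1 <;> rcases h₂diag j with h2 | h2 <;> rw [h1, h2] at this
    · left; linarith
    · right; linarith
    · right; linarith
    · left; linarith
end
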